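/- arXiv:1808.03592 — 2 statements merged into one kernel-verified Lean document; each statement's English description precedes it below -/
import Mathlib

section
/- Let N ≥ 1 and x0 ∈ F_{N+1}. Then x*_{N+1}(x0,1) ∈ F_N, the truncated input sequence (u*_{N+1}(x0,1), …, u*_{N+1}(x0,N)) is the unique optimal sequence for horizon N at initial state x*_{N+1}(x0,1), and the active pattern of x*_{N+1}(x0,1) for horizon N is the tail of the active pattern of x0 for horizon N+1: for every 0 ≤ k ≤ N−1, the active state rows and active input rows at stage k of the horizon-N problem at x*_{N+1}(x0,1) coincide with those at stage k+1 of the horizon-(N+1) problem at x0, and the sets of active terminal rows coincide. Consequently, with the constraints ordered stage by stage, every active set a_{N+1} for horizon N+1 has the form a_{N+1} = α a_N for some active set a_N for horizon N and some tuple α of length qX + qU. -/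
open Matrix Set

noncomputable section

/-- State trajectory generated by dynamics `x(k+1) = A x(k) + B u(k)` from `x0`. -/
def traj {n m : ℕ} (A : Matrix (Fin n) (Fin n) ℝ) (B : Matrix (Fin n) (Fin m) ℝ)
    (x0 : Fin n → ℝ) (u : ℕ → Fin m → ℝ) : ℕ → Fin n → ℝ
  | 0 => x0
  | k + 1 => A *ᵥ traj A B x0 u k + B *ᵥ u k

/-- Feasibility of a control sequence for horizon `N` and initial state `x0`. -/
def Feasible {n m qX qU qT : ℕ} (A : Matrix (Fin n) (Fin n) ℝ) (B : Matrix (Fin n) (Fin m) ℝ)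
    (Cx : Matrix (Fin qX) (Fin n) ℝ) (cx : Fin qX → ℝ)
    (Cu : Matrix (Fin qU) (Fin m) ℝ) (cu : Fin qU → ℝ)
    (Ct : Matrix (Fin qT) (Fin n) ℝ) (ct : Fin qT → ℝ)
    (N : ℕ) (x0 : Fin n → ℝ) (u : ℕ → Fin m → ℝ) : Prop :=
  (∀ k < N, Cx *ᵥ traj A B x0 u k ≤ cx ∧ Cu *ᵥ u k ≤ cu) ∧
    Ct *ᵥ traj A B x0 u N ≤ ct

/-- The quadratic cost `J_N(x0, u)`. -/
def cost {n m : ℕ} (A : Matrix (Fin n) (Fin n) ℝ) (B : Matrix (Fin n) (Fin m) ℝ)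
    (Q : Matrix (Fin n) (Fin n) ℝ) (R : Matrix (Fin m) (Fin m) ℝ)
    (P : Matrix (Fin n) (Fin n) ℝ)
    (N : ℕ) (x0 : Fin n → ℝ) (u : ℕ → Fin m → ℝ) : ℝ :=
  (1 / 2) * (traj A B x0 u N ⬝ᵥ (P *ᵥ traj A B x0 u N)) +
    (1 / 2) * ∑ k ∈ Finset.range N,
      (traj A B x0 u k ⬝ᵥ (Q *ᵥ traj A B x0 u k) + u k ⬝ᵥ (R *ᵥ u k))

/-- `u` is an optimal (feasible, cost-minimizing) sequence for horizon `N` at `x0`. -/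
def IsOptimal {n m qX qU qT : ℕ} (A : Matrix (Fin n) (Fin n) ℝ) (B : Matrix (Fin n) (Fin m) ℝ)
    (Q : Matrix (Fin n) (Fin n) ℝ) (R : Matrix (Fin m) (Fin m) ℝ)
    (P : Matrix (Fin n) (Fin n) ℝ)
    (Cx : Matrix (Fin qX) (Fin n) ℝ) (cx : Fin qX → ℝ)
    (Cu : Matrix (Fin qU) (Fin m) ℝ) (cu : Fin qU → ℝ)
    (Ct : Matrix (Fin qT) (Fin n) ℝ) (ct : Fin qT → ℝ)
    (N : ℕ) (x0 : Fin n → ℝ) (u : ℕ → Fin m → ℝ) : Prop :=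
  Feasible A B Cx cx Cu cu Ct ct N x0 u ∧
    ∀ v, Feasible A B Cx cx Cu cu Ct ct N x0 v →
      cost A B Q R P N x0 u ≤ cost A B Q R P N x0 v

/-- The feasible set `F_N` of initial states. -/
def FeasSet {n m qX qU qT : ℕ} (A : Matrix (Fin n) (Fin n) ℝ) (B : Matrix (Fin n) (Fin m) ℝ)
    (Cx : Matrix (Fin qX) (Fin n) ℝ) (cx : Fin qX → ℝ)
    (Cu : Matrix (Fin qU) (Fin m) ℝ) (cu : Fin qU → ℝ)
    (Ct : Matrix (Fin qT) (Fin n) ℝ) (ct : Fin qT → ℝ)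
    (N : ℕ) : Set (Fin n → ℝ) :=
  {x0 | ∃ u, Feasible A B Cx cx Cu cu Ct ct N x0 u}

section Trajectories

variable {n m : ℕ} (A : Matrix (Fin n) (Fin n) ℝ) (B : Matrix (Fin n) (Fin m) ℝ)

theorem traj_tail (x0 : Fin n → ℝ) (u : ℕ → Fin m → ℝ) (k : ℕ) :
    traj A B (traj A B x0 u 1) (fun j => u (j + 1)) k = traj A B x0 u (k + 1) := by
  induction k with
  | zero => rfl
  | succ k ih => rw [traj, ih, ← traj]

theorem traj_add (x y : Fin n → ℝ) (u v : ℕ → Fin m → ℝ) (k : ℕ) :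
    traj A B (x + y) (u + v) k = traj A B x u k + traj A B y v k := by
  induction k with
  | zero => rfl
  | succ k ih =>
    simp only [traj, ih, Pi.add_apply, Matrix.mulVec_add]
    abel

theorem traj_smul (c : ℝ) (x : Fin n → ℝ) (u : ℕ → Fin m → ℝ) (k : ℕ) :
    traj A B (c • x) (c • u) k = c • traj A B x u k := by
  induction k with
  | zero => rfl
  | succ k ih => simp only [traj, ih, Pi.smul_apply, Matrix.mulVec_smul, smul_add]

theorem traj_sub (x y : Fin n → ℝ) (u v : ℕ → Fin m → ℝ) (k : ℕ) :
    traj A B (x - y) (u - v) k = traj A B x u k - traj A B y v k := by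
  rw [eq_sub_iff_add_eq, ← traj_add, sub_add_cancel, sub_add_cancel]

/-- The sequence that applies `a` first and `v` afterwards. -/
def prependInput (a : Fin m → ℝ) (v : ℕ → Fin m → ℝ) : ℕ → Fin m → ℝ
  | 0 => a
  | k + 1 => v k

end Trajectories

section Quadratic

theorem dotProduct_mulVec_parallelogram {d : ℕ} (M : Matrix (Fin d) (Fin d) ℝ) (x y : Fin d → ℝ) :
    (x + y) ⬝ᵥ (M *ᵥ (x + y)) + (x - y) ⬝ᵥ (M *ᵥ (x - y)) =
      2 * (x ⬝ᵥ (M *ᵥ x)) + 2 * (y ⬝ᵥ (M *ᵥ y)) := by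
  simp only [Matrix.mulVec_add, Matrix.mulVec_sub, add_dotProduct, sub_dotProduct, dotProduct_add,
    dotProduct_sub]
  ring

theorem Matrix.PosSemidef.dotProduct_mulVec_nonneg_real {d : ℕ} {M : Matrix (Fin d) (Fin d) ℝ}
    (hM : M.PosSemidef) (x : Fin d → ℝ) : 0 ≤ x ⬝ᵥ (M *ᵥ x) := by
  simpa using hM.dotProduct_mulVec_nonneg x

theorem Matrix.PosDef.dotProduct_mulVec_pos_real {d : ℕ} {M : Matrix (Fin d) (Fin d) ℝ}
    (hM : M.PosDef) {x : Fin d → ℝ} (hx : x ≠ 0) : 0 < x ⬝ᵥ (M *ᵥ x) := by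
  simpa using hM.dotProduct_mulVec_pos hx

end Quadratic

section Cost

variable {n m : ℕ} (A : Matrix (Fin n) (Fin n) ℝ) (B : Matrix (Fin n) (Fin m) ℝ)
  (Q : Matrix (Fin n) (Fin n) ℝ) (R : Matrix (Fin m) (Fin m) ℝ) (P : Matrix (Fin n) (Fin n) ℝ)

theorem cost_succ (N : ℕ) (x0 : Fin n → ℝ) (u : ℕ → Fin m → ℝ) :
    cost A B Q R P (N + 1) x0 u =
      (1 / 2) * (x0 ⬝ᵥ (Q *ᵥ x0) + u 0 ⬝ᵥ (R *ᵥ u 0)) +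
        cost A B Q R P N (traj A B x0 u 1) (fun j => u (j + 1)) := by
  simp only [cost, traj_tail, Finset.sum_range_succ']
  simp only [traj]
  ring

theorem cost_smul (c : ℝ) (N : ℕ) (x : Fin n → ℝ) (u : ℕ → Fin m → ℝ) :
    cost A B Q R P N (c • x) (c • u) = c ^ 2 * cost A B Q R P N x u := by
  simp only [cost, traj_smul, Pi.smul_apply, Matrix.mulVec_smul, smul_dotProduct, dotProduct_smul,
    smul_eq_mul, mul_add, Finset.mul_sum]
  refine congrArg₂ _ (by ring) (Finset.sum_congr rfl fun k _ => by ring)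

theorem cost_parallelogram (N : ℕ) (x y : Fin n → ℝ) (u v : ℕ → Fin m → ℝ) :
    cost A B Q R P N (x + y) (u + v) + cost A B Q R P N (x - y) (u - v) =
      2 * cost A B Q R P N x u + 2 * cost A B Q R P N y v := by
  have hs : ∀ (f g h k : ℕ → ℝ), (∀ i, f i + g i = 2 * h i + 2 * k i) →
      ∑ i ∈ Finset.range N, f i + ∑ i ∈ Finset.range N, g i =
        2 * ∑ i ∈ Finset.range N, h i + 2 * ∑ i ∈ Finset.range N, k i := by
    intro f g h k H
    simp only [Finset.mul_sum, ← Finset.sum_add_distrib, H]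
  have h1 := dotProduct_mulVec_parallelogram P (traj A B x u N) (traj A B y v N)
  have h2 := hs
    (fun k => (traj A B x u k + traj A B y v k) ⬝ᵥ (Q *ᵥ (traj A B x u k + traj A B y v k)) +
      (u k + v k) ⬝ᵥ (R *ᵥ (u k + v k)))
    (fun k => (traj A B x u k - traj A B y v k) ⬝ᵥ (Q *ᵥ (traj A B x u k - traj A B y v k)) +
      (u k - v k) ⬝ᵥ (R *ᵥ (u k - v k)))
    (fun k => traj A B x u k ⬝ᵥ (Q *ᵥ traj A B x u k) + u k ⬝ᵥ (R *ᵥ u k))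
    (fun k => traj A B y v k ⬝ᵥ (Q *ᵥ traj A B y v k) + v k ⬝ᵥ (R *ᵥ v k))
    (fun k => by
      have hQ := dotProduct_mulVec_parallelogram Q (traj A B x u k) (traj A B y v k)
      have hR := dotProduct_mulVec_parallelogram R (u k) (v k)
      linarith)
  simp only [cost, traj_add, traj_sub, Pi.add_apply, Pi.sub_apply]
  linarith

variable {Q R P}

theorem eq_zero_of_cost_nonpos (hQ : Q.PosSemidef) (hR : R.PosDef) (hP : P.PosSemidef) {N : ℕ}
    {x : Fin n → ℝ} {u : ℕ → Fin m → ℝ} (h : cost A B Q R P N x u ≤ 0) {k : ℕ} (hk : k < N) :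
    u k = 0 := by
  by_contra hne
  have hpos : 0 < ∑ k ∈ Finset.range N,
      (traj A B x u k ⬝ᵥ (Q *ᵥ traj A B x u k) + u k ⬝ᵥ (R *ᵥ u k)) :=
    Finset.sum_pos'
      (fun i _ => add_nonneg (hQ.dotProduct_mulVec_nonneg_real _)
        (hR.posSemidef.dotProduct_mulVec_nonneg_real _))
      ⟨k, Finset.mem_range.2 hk, add_pos_of_nonneg_of_pos (hQ.dotProduct_mulVec_nonneg_real _)
        (hR.dotProduct_mulVec_pos_real hne)⟩
  have hN := hP.dotProduct_mulVec_nonneg_real (traj A B x u N)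
  unfold cost at h
  linarith

end Cost

section Optimality

variable {n m qX qU qT : ℕ} {A : Matrix (Fin n) (Fin n) ℝ} {B : Matrix (Fin n) (Fin m) ℝ}
  {Q : Matrix (Fin n) (Fin n) ℝ} {R : Matrix (Fin m) (Fin m) ℝ} {P : Matrix (Fin n) (Fin n) ℝ}
  {Cx : Matrix (Fin qX) (Fin n) ℝ} {cx : Fin qX → ℝ}
  {Cu : Matrix (Fin qU) (Fin m) ℝ} {cu : Fin qU → ℝ}
  {Ct : Matrix (Fin qT) (Fin n) ℝ} {ct : Fin qT → ℝ}
  {N : ℕ} {x0 : Fin n → ℝ} {u v : ℕ → Fin m → ℝ}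

theorem feasible_succ_iff :
    Feasible A B Cx cx Cu cu Ct ct (N + 1) x0 u ↔
      (Cx *ᵥ x0 ≤ cx ∧ Cu *ᵥ u 0 ≤ cu) ∧
        Feasible A B Cx cx Cu cu Ct ct N (traj A B x0 u 1) (fun j => u (j + 1)) := by
  simp only [Feasible, traj_tail, ← and_assoc]
  refine and_congr_left fun _ => ⟨fun h => ⟨h 0 N.succ_pos, fun k hk => h (k + 1) (by omega)⟩, ?_⟩
  rintro ⟨h0, h⟩ (_ | k) hk
  · exact h0
  · exact h k (by omega)

theorem mulVec_midpoint_le {p d : ℕ} {C : Matrix (Fin p) (Fin d) ℝ} {c : Fin p → ℝ}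
    {x y : Fin d → ℝ} (hx : C *ᵥ x ≤ c) (hy : C *ᵥ y ≤ c) :
    C *ᵥ ((1 / 2 : ℝ) • (x + y)) ≤ c := by
  intro i
  have h1 := hx i
  have h2 := hy i
  simp only [Matrix.mulVec_smul, Matrix.mulVec_add, Pi.smul_apply, Pi.add_apply, smul_eq_mul]
  linarith

theorem half_smul_add_self (x : Fin n → ℝ) : (1 / 2 : ℝ) • (x + x) = x := by
  ext i
  simp only [Pi.smul_apply, Pi.add_apply, smul_eq_mul]
  ring

theorem Feasible.midpoint (hu : Feasible A B Cx cx Cu cu Ct ct N x0 u)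
    (hv : Feasible A B Cx cx Cu cu Ct ct N x0 v) :
    Feasible A B Cx cx Cu cu Ct ct N x0 ((1 / 2 : ℝ) • (u + v)) := by
  have ht : ∀ k, traj A B x0 ((1 / 2 : ℝ) • (u + v)) k =
      (1 / 2 : ℝ) • (traj A B x0 u k + traj A B x0 v k) := fun k => by
    rw [← traj_add, ← traj_smul, half_smul_add_self]
  simp only [Feasible, ht]
  exact ⟨fun k hk => ⟨mulVec_midpoint_le (hu.1 k hk).1 (hv.1 k hk).1,
    mulVec_midpoint_le (hu.1 k hk).2 (hv.1 k hk).2⟩, mulVec_midpoint_le hu.2 hv.2⟩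

theorem IsOptimal.eq_of_isOptimal (hQ : Q.PosSemidef) (hR : R.PosDef) (hP : P.PosSemidef)
    (hu : IsOptimal A B Q R P Cx cx Cu cu Ct ct N x0 u)
    (hv : IsOptimal A B Q R P Cx cx Cu cu Ct ct N x0 v) {k : ℕ} (hk : k < N) : u k = v k := by
  have hmid := hu.2 _ (hu.1.midpoint hv.1)
  have hvu := hv.2 _ hu.1
  have hs := cost_smul A B Q R P (1 / 2) N (x0 + x0) (u + v)
  rw [half_smul_add_self] at hs
  have hpar := cost_parallelogram A B Q R P N x0 x0 u v
  have hle : cost A B Q R P N (x0 - x0) (u - v) ≤ 0 := by linarith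
  exact sub_eq_zero.1 (eq_zero_of_cost_nonpos A B hQ hR hP hle hk)

/-- Bellman's principle: the tail of an optimal sequence is optimal. -/
theorem IsOptimal.tail (hu : IsOptimal A B Q R P Cx cx Cu cu Ct ct (N + 1) x0 u) :
    IsOptimal A B Q R P Cx cx Cu cu Ct ct N (traj A B x0 u 1) (fun j => u (j + 1)) := by
  obtain ⟨h0, hfeas⟩ := feasible_succ_iff.1 hu.1
  refine ⟨hfeas, fun v hv => ?_⟩
  have h := hu.2 (prependInput (u 0) v) (feasible_succ_iff.2 ⟨h0, hv⟩)
  rw [cost_succ, cost_succ] at h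
  exact le_of_add_le_add_left h

end Optimality

/-- tails of active sets for horizon `N+1` are active sets for horizon `N`. -/
theorem stmt0
    {n m qX qU qT : ℕ}
    (A : Matrix (Fin n) (Fin n) ℝ) (B : Matrix (Fin n) (Fin m) ℝ)
    (Q : Matrix (Fin n) (Fin n) ℝ) (R : Matrix (Fin m) (Fin m) ℝ)
    (P : Matrix (Fin n) (Fin n) ℝ)
    (Cx : Matrix (Fin qX) (Fin n) ℝ) (cx : Fin qX → ℝ)
    (Cu : Matrix (Fin qU) (Fin m) ℝ) (cu : Fin qU → ℝ)
    (Ct : Matrix (Fin qT) (Fin n) ℝ) (ct : Fin qT → ℝ)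
    (hQ : Q.PosSemidef) (hR : R.PosDef) (hP : P.PosSemidef)
    (N : ℕ) (hN : 1 ≤ N)
    (x0 : Fin n → ℝ) (u : ℕ → Fin m → ℝ)
    (hu : IsOptimal A B Q R P Cx cx Cu cu Ct ct (N + 1) x0 u) :
    traj A B x0 u 1 ∈ FeasSet A B Cx cx Cu cu Ct ct N ∧
    IsOptimal A B Q R P Cx cx Cu cu Ct ct N (traj A B x0 u 1) (fun j => u (j + 1)) ∧
    (∀ v, IsOptimal A B Q R P Cx cx Cu cu Ct ct N (traj A B x0 u 1) v → ∀ k < N, v k = u (k + 1)) ∧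
    (∀ k < N,
      (∀ i, (Cx *ᵥ traj A B (traj A B x0 u 1) (fun j => u (j + 1)) k) i = cx i ↔
            (Cx *ᵥ traj A B x0 u (k + 1)) i = cx i) ∧
      (∀ j, (Cu *ᵥ (fun j' => u (j' + 1)) k) j = cu j ↔ (Cu *ᵥ u (k + 1)) j = cu j)) ∧
    (∀ r, (Ct *ᵥ traj A B (traj A B x0 u 1) (fun j => u (j + 1)) N) r = ct r ↔
          (Ct *ᵥ traj A B x0 u (N + 1)) r = ct r) := by
  refine ⟨⟨_, hu.tail.1⟩, hu.tail, fun v hv k hk => hv.eq_of_isOptimal hQ hR hP hu.tail hk,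
    fun k _ => ⟨fun i => ?_, fun j => Iff.rfl⟩, fun r => ?_⟩
  · rw [traj_tail]
  · rw [traj_tail]
end
end

section
/- Let N ≥ 1, l ≥ 0, and x0 ∈ F_N with Ct x*_N(x0,N) < ct componentwise (no terminal constraint active for horizon N). Then x0 ∈ F_{N+l}, and the extension of the horizon-N optimal solution, namely u*(k) = u*_N(x0,k) for 0 ≤ k ≤ N−1 and u*(k) = K∞ x*(k) for N ≤ k ≤ N+l−1 with x*(k+1) = (A + B K∞) x*(k) and x*(N) = x*_N(x0,N), is the unique optimal sequence for horizon N+l at x0. Moreover its active pattern agrees with the horizon-N active pattern of x0 on the stages 0,…,N−1, no state or input constraint is active at any stage N ≤ k ≤ N+l−1 (Cx x*(k) < cx and Cu u*(k) < cu componentwise), and no terminal constraint is active (Ct x*(N+l) < ct componentwise). -/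
open Matrix Set

noncomputable section

section LQRExtension

variable {n m : ℕ}

lemma traj_congr (A : Matrix (Fin n) (Fin n) ℝ) (B : Matrix (Fin n) (Fin m) ℝ) (x0 : Fin n → ℝ)
    {u v : ℕ → Fin m → ℝ} {k : ℕ} (h : ∀ j < k, u j = v j) :
    traj A B x0 u k = traj A B x0 v k := by
  induction k with
  | zero => rfl
  | succ k ih => rw [traj, traj, ih fun j hj => h j (by omega), h k (by omega)]

lemma traj_lineMap (A : Matrix (Fin n) (Fin n) ℝ) (B : Matrix (Fin n) (Fin m) ℝ) (x0 : Fin n → ℝ)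
    (u v : ℕ → Fin m → ℝ) (t : ℝ) (k : ℕ) :
    traj A B x0 (fun j => (1 - t) • u j + t • v j) k =
      (1 - t) • traj A B x0 u k + t • traj A B x0 v k := by
  induction k with
  | zero => simp only [traj]; module
  | succ k ih =>
    simp only [traj, ih, mulVec_add, mulVec_smul]
    module

/-- Once the control is the linear feedback `K`, the states evolve under the closed-loop matrix. -/
lemma traj_feedback (A : Matrix (Fin n) (Fin n) ℝ) (B : Matrix (Fin n) (Fin m) ℝ)
    (K : Matrix (Fin m) (Fin n) ℝ) (x0 : Fin n → ℝ) (u : ℕ → Fin m → ℝ) (N : ℕ)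
    (h : ∀ j, u (N + j) = K *ᵥ ((A + B * K) ^ j *ᵥ traj A B x0 u N)) (j : ℕ) :
    traj A B x0 u (N + j) = (A + B * K) ^ j *ᵥ traj A B x0 u N := by
  induction j with
  | zero => simp
  | succ j ih =>
    rw [← add_assoc, traj, ih, h]
    simp only [pow_succ', ← mulVec_mulVec, add_mulVec]

lemma quadForm_lineMap (S : Matrix (Fin m) (Fin m) ℝ) (a b : Fin m → ℝ) (t : ℝ) :
    ((1 - t) • a + t • b) ⬝ᵥ (S *ᵥ ((1 - t) • a + t • b)) =
      (1 - t) * (a ⬝ᵥ (S *ᵥ a)) + t * (b ⬝ᵥ (S *ᵥ b)) -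
        t * (1 - t) * ((b - a) ⬝ᵥ (S *ᵥ (b - a))) := by
  simp only [mulVec_add, mulVec_sub, mulVec_smul, dotProduct_add, add_dotProduct, dotProduct_sub,
    sub_dotProduct, dotProduct_smul, smul_dotProduct, smul_eq_mul]
  ring

/-- Completion of squares in one stage of the cost, for a solution `P` of the Riccati equation. -/
lemma riccati_stage {A : Matrix (Fin n) (Fin n) ℝ} {B : Matrix (Fin n) (Fin m) ℝ}
    {Q P : Matrix (Fin n) (Fin n) ℝ} {R : Matrix (Fin m) (Fin m) ℝ} {K : Matrix (Fin m) (Fin n) ℝ}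
    (hR : Rᵀ = R) (hP : Pᵀ = P) (hdet : IsUnit (R + Bᵀ * P * B).det)
    (hRic : P = Aᵀ * (P - P * B * (R + Bᵀ * P * B)⁻¹ * (Bᵀ * P)) * A + Q)
    (hK : K = -((Bᵀ * P * B + R)⁻¹ * (Bᵀ * P * A))) (x : Fin n → ℝ) (v : Fin m → ℝ) :
    x ⬝ᵥ (Q *ᵥ x) + v ⬝ᵥ (R *ᵥ v) + (A *ᵥ x + B *ᵥ v) ⬝ᵥ (P *ᵥ (A *ᵥ x + B *ᵥ v)) =
      x ⬝ᵥ (P *ᵥ x) + (v - K *ᵥ x) ⬝ᵥ ((R + Bᵀ * P * B) *ᵥ (v - K *ᵥ x)) := by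
  rw [add_comm (Bᵀ * P * B) R] at hK
  obtain ⟨S, hS⟩ : ∃ S, S = R + Bᵀ * P * B := ⟨_, rfl⟩
  rw [← hS] at hdet hRic hK ⊢
  have hSt : Sᵀ = S := by
    simp only [hS, transpose_add, transpose_mul, transpose_transpose, hR, hP, Matrix.mul_assoc]
  have hSK : S * K = -(Bᵀ * P * A) := by
    rw [hK, Matrix.mul_neg, ← Matrix.mul_assoc, Matrix.mul_nonsing_inv _ hdet, Matrix.one_mul]
  have hKS : Kᵀ * S = -(Aᵀ * P * B) := by
    have := congrArg transpose hSK
    simpa only [transpose_mul, transpose_neg, transpose_transpose, hSt, hP, Matrix.mul_assoc]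
      using this
  have hQ : Q + Aᵀ * P * A = P + Kᵀ * S * K := by
    have h1 : Kᵀ * S * K = Aᵀ * (P * B * S⁻¹ * (Bᵀ * P)) * A := by
      rw [hKS, hK]
      simp only [Matrix.neg_mul, Matrix.mul_neg, neg_neg, Matrix.mul_assoc]
    rw [Matrix.mul_sub, Matrix.sub_mul, ← h1] at hRic
    nth_rewrite 2 [hRic]
    abel
  have e1 := congrArg (fun M => x ⬝ᵥ (M *ᵥ x)) hQ
  have e2 := congrArg (fun M => v ⬝ᵥ (M *ᵥ x)) hSK
  have e3 := congrArg (fun M => x ⬝ᵥ (M *ᵥ v)) hKS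
  have e4 := congrArg (fun M => v ⬝ᵥ (M *ᵥ v)) hS
  simp only [add_mulVec, neg_mulVec, ← mulVec_mulVec, dotProduct_add, dotProduct_neg] at e1 e2 e3 e4
  simp only [mulVec_add, mulVec_sub, dotProduct_add, add_dotProduct, dotProduct_sub,
    sub_dotProduct]
  have c1 (a b : Fin n → ℝ) : (A *ᵥ a) ⬝ᵥ b = a ⬝ᵥ (Aᵀ *ᵥ b) := by
    rw [dotProduct_mulVec, vecMul_transpose]
  have c2 (a : Fin m → ℝ) (b : Fin n → ℝ) : (B *ᵥ a) ⬝ᵥ b = a ⬝ᵥ (Bᵀ *ᵥ b) := by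
    rw [dotProduct_mulVec, vecMul_transpose]
  have c3 (a : Fin n → ℝ) (b : Fin m → ℝ) : (K *ᵥ a) ⬝ᵥ b = a ⬝ᵥ (Kᵀ *ᵥ b) := by
    rw [dotProduct_mulVec, vecMul_transpose]
  simp only [c1, c2, c3]
  linarith

/-- The deviation of a control sequence from the linear feedback `K`. -/
def feedbackGap (A : Matrix (Fin n) (Fin n) ℝ) (B : Matrix (Fin n) (Fin m) ℝ)
    (K : Matrix (Fin m) (Fin n) ℝ) (x0 : Fin n → ℝ) (u : ℕ → Fin m → ℝ) (k : ℕ) : Fin m → ℝ :=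
  u k - K *ᵥ traj A B x0 u k

lemma feedbackGap_lineMap (A : Matrix (Fin n) (Fin n) ℝ) (B : Matrix (Fin n) (Fin m) ℝ)
    (K : Matrix (Fin m) (Fin n) ℝ) (x0 : Fin n → ℝ) (u v : ℕ → Fin m → ℝ) (t : ℝ) (k : ℕ) :
    feedbackGap A B K x0 (fun j => (1 - t) • u j + t • v j) k =
      (1 - t) • feedbackGap A B K x0 u k + t • feedbackGap A B K x0 v k := by
  simp only [feedbackGap, traj_lineMap, mulVec_add, mulVec_smul]
  module

/-- A control sequence is determined by its deviation from linear feedback. -/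
lemma eq_of_feedbackGap_eq {A : Matrix (Fin n) (Fin n) ℝ} {B : Matrix (Fin n) (Fin m) ℝ}
    {K : Matrix (Fin m) (Fin n) ℝ} {x0 : Fin n → ℝ} {u v : ℕ → Fin m → ℝ} {N : ℕ}
    (h : ∀ k < N, feedbackGap A B K x0 u k = feedbackGap A B K x0 v k) :
    ∀ k < N, u k = v k := by
  intro k
  induction k using Nat.strong_induction_on with
  | _ k ih =>
    intro hk
    have := h k hk
    rwa [feedbackGap, feedbackGap, traj_congr A B x0 fun j hj => ih j hj (hj.trans hk),
      sub_left_inj] at this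

lemma cost_eq_sum_feedbackGap {A : Matrix (Fin n) (Fin n) ℝ} {B : Matrix (Fin n) (Fin m) ℝ}
    {Q P : Matrix (Fin n) (Fin n) ℝ} {R : Matrix (Fin m) (Fin m) ℝ} {K : Matrix (Fin m) (Fin n) ℝ}
    (hR : Rᵀ = R) (hP : Pᵀ = P) (hdet : IsUnit (R + Bᵀ * P * B).det)
    (hRic : P = Aᵀ * (P - P * B * (R + Bᵀ * P * B)⁻¹ * (Bᵀ * P)) * A + Q)
    (hK : K = -((Bᵀ * P * B + R)⁻¹ * (Bᵀ * P * A))) (N : ℕ) (x0 : Fin n → ℝ)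
    (u : ℕ → Fin m → ℝ) :
    cost A B Q R P N x0 u = (1 / 2) * (x0 ⬝ᵥ (P *ᵥ x0)) + (1 / 2) * ∑ k ∈ Finset.range N,
      feedbackGap A B K x0 u k ⬝ᵥ ((R + Bᵀ * P * B) *ᵥ feedbackGap A B K x0 u k) := by
  induction N with
  | zero => simp [cost, traj]
  | succ N ih =>
    have h := riccati_stage hR hP hdet hRic hK (traj A B x0 u N) (u N)
    rw [Finset.sum_range_succ, mul_add, ← add_assoc, ← ih]
    simp only [cost, Finset.sum_range_succ, feedbackGap]
    rw [traj]
    linarith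

/-- Strict inequalities persist for a short while along a segment. -/
lemma exists_pos_lineMap_lt {ι : Type*} [Finite ι] {a c : ι → ℝ} (h : ∀ i, a i < c i) (b : ι → ℝ) :
    ∃ t : ℝ, 0 < t ∧ t ≤ 1 / 2 ∧ ∀ i, (1 - t) * a i + t * b i < c i := by
  have h1 : ∀ᶠ t : ℝ in nhdsWithin 0 (Ioi 0), ∀ i, (1 - t) * a i + t * b i < c i := by
    rw [Filter.eventually_all]
    intro i
    have hc : ContinuousAt (fun t : ℝ => (1 - t) * a i + t * b i) 0 := by fun_prop
    exact (hc.eventually_lt continuousAt_const (by simpa using h i)).filter_mono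
      nhdsWithin_le_nhds
  obtain ⟨t, ht, ht0, ht1⟩ := (h1.and (Ioc_mem_nhdsGT (show (0 : ℝ) < 1 / 2 by norm_num))).exists
  exact ⟨t, ht0, ht1, ht⟩

lemma mulVec_lineMap_le {q : ℕ} {C : Matrix (Fin q) (Fin n) ℝ} {c : Fin q → ℝ} {x y : Fin n → ℝ}
    (hx : C *ᵥ x ≤ c) (hy : C *ᵥ y ≤ c) {t : ℝ} (h0 : 0 ≤ t) (h1 : t ≤ 1) :
    C *ᵥ ((1 - t) • x + t • y) ≤ c := by
  have hconv : Convex ℝ {x | C *ᵥ x ≤ c} :=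
    (convex_Iic c).is_linear_preimage (C.mulVecLin.isLinear)
  exact hconv hx hy (by linarith) h0 (by ring)

lemma mulVec_lt_of_smul_le {q : ℕ} {C : Matrix (Fin q) (Fin n) ℝ} {c : Fin q → ℝ} {x : Fin n → ℝ}
    {t : ℝ} (ht : 0 < t) (hc : ∀ i, 0 < c i) (h : C *ᵥ ((1 + t) • x) ≤ c) (i : Fin q) :
    (C *ᵥ x) i < c i := by
  have hi := h i
  rw [mulVec_smul, Pi.smul_apply, smul_eq_mul] at hi
  rcases le_or_gt ((C *ᵥ x) i) 0 with h0 | h0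
  · exact h0.trans_lt (hc i)
  · nlinarith [mul_pos ht h0]

/-- When the terminal constraint is inactive at the optimum, optimality (with a quadratic margin)
persists against sequences that only satisfy the stage constraints. -/
lemma IsOptimal.cost_add_le {qX qU qT : ℕ}
    {A : Matrix (Fin n) (Fin n) ℝ} {B : Matrix (Fin n) (Fin m) ℝ}
    {Q P : Matrix (Fin n) (Fin n) ℝ} {R : Matrix (Fin m) (Fin m) ℝ} {K : Matrix (Fin m) (Fin n) ℝ}
    {Cx : Matrix (Fin qX) (Fin n) ℝ} {cx : Fin qX → ℝ}
    {Cu : Matrix (Fin qU) (Fin m) ℝ} {cu : Fin qU → ℝ}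
    {Ct : Matrix (Fin qT) (Fin n) ℝ} {ct : Fin qT → ℝ}
    {N : ℕ} {x0 : Fin n → ℝ} {u v : ℕ → Fin m → ℝ}
    (hu : IsOptimal A B Q R P Cx cx Cu cu Ct ct N x0 u)
    (hR : Rᵀ = R) (hP : Pᵀ = P) (hS : (R + Bᵀ * P * B).PosDef)
    (hRic : P = Aᵀ * (P - P * B * (R + Bᵀ * P * B)⁻¹ * (Bᵀ * P)) * A + Q)
    (hK : K = -((Bᵀ * P * B + R)⁻¹ * (Bᵀ * P * A)))
    (hterm : ∀ r, (Ct *ᵥ traj A B x0 u N) r < ct r)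
    (hv : ∀ k < N, Cx *ᵥ traj A B x0 v k ≤ cx ∧ Cu *ᵥ v k ≤ cu) :
    cost A B Q R P N x0 u + (1 / 4) * ∑ k ∈ Finset.range N,
        (feedbackGap A B K x0 v k - feedbackGap A B K x0 u k) ⬝ᵥ
          ((R + Bᵀ * P * B) *ᵥ (feedbackGap A B K x0 v k - feedbackGap A B K x0 u k)) ≤
      cost A B Q R P N x0 v := by
  obtain ⟨t, ht0, ht1, ht⟩ := exists_pos_lineMap_lt hterm (Ct *ᵥ traj A B x0 v N)
  have hle := hu.2 (fun j => (1 - t) • u j + t • v j) ⟨fun k hk => ?_, fun r => ?_⟩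
  · have hdet : IsUnit (R + Bᵀ * P * B).det := hS.det_pos.ne'.isUnit
    have hD : 0 ≤ ∑ k ∈ Finset.range N,
        (feedbackGap A B K x0 v k - feedbackGap A B K x0 u k) ⬝ᵥ
          ((R + Bᵀ * P * B) *ᵥ (feedbackGap A B K x0 v k - feedbackGap A B K x0 u k)) :=
      Finset.sum_nonneg fun k _ => by
        simpa only [star_trivial] using hS.posSemidef.dotProduct_mulVec_nonneg _
    simp only [cost_eq_sum_feedbackGap hR hP hdet hRic hK, feedbackGap_lineMap, quadForm_lineMap,
      Finset.sum_add_distrib, Finset.sum_sub_distrib, ← Finset.mul_sum] at hle ⊢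
    set D := ∑ k ∈ Finset.range N,
        (feedbackGap A B K x0 v k - feedbackGap A B K x0 u k) ⬝ᵥ
          ((R + Bᵀ * P * B) *ᵥ (feedbackGap A B K x0 v k - feedbackGap A B K x0 u k))
    refine le_of_mul_le_mul_left ?_ ht0
    nlinarith [mul_nonneg (mul_nonneg ht0.le (sub_nonneg.2 ht1)) hD]
  · rw [traj_lineMap]
    exact ⟨mulVec_lineMap_le (hu.1.1 k hk).1 (hv k hk).1 ht0.le (by linarith),
      mulVec_lineMap_le (hu.1.1 k hk).2 (hv k hk).2 ht0.le (by linarith)⟩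
  · rw [traj_lineMap, mulVec_add, mulVec_smul, mulVec_smul]
    exact (ht r).le

end LQRExtension

/-- if no terminal constraint is active for horizon `N`, the LQR extension of the
optimal solution is the unique optimal solution for horizon `N+l`, with the same active pattern
on the first `N` stages, strictly inactive constraints afterwards, and inactive terminal
constraints. -/
theorem stmt2
    {n m qX qU qT : ℕ}
    (A : Matrix (Fin n) (Fin n) ℝ) (B : Matrix (Fin n) (Fin m) ℝ)
    (Q : Matrix (Fin n) (Fin n) ℝ) (R : Matrix (Fin m) (Fin m) ℝ)
    (P : Matrix (Fin n) (Fin n) ℝ)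
    (Cx : Matrix (Fin qX) (Fin n) ℝ) (cx : Fin qX → ℝ)
    (Cu : Matrix (Fin qU) (Fin m) ℝ) (cu : Fin qU → ℝ)
    (Ct : Matrix (Fin qT) (Fin n) ℝ) (ct : Fin qT → ℝ)
    (hQ : Q.PosSemidef) (hR : R.PosDef) (hP : P.PosSemidef)
    (Kinf : Matrix (Fin m) (Fin n) ℝ)
    (hdet : IsUnit (R + Bᵀ * P * B).det)
    (hRic : P = Aᵀ * (P - P * B * (R + Bᵀ * P * B)⁻¹ * (Bᵀ * P)) * A + Q)
    (hK : Kinf = -((Bᵀ * P * B + R)⁻¹ * (Bᵀ * P * A)))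
    (Xs : Set (Fin n → ℝ)) (hXs : Xs = {x | Cx *ᵥ x ≤ cx})
    (Us : Set (Fin m → ℝ)) (hUs : Us = {v | Cu *ᵥ v ≤ cu})
    (Ts : Set (Fin n → ℝ)) (hTs : Ts = {x | Ct *ᵥ x ≤ ct})
    (XU : Set (Fin n → ℝ)) (hXU : XU = {x ∈ Xs | Kinf *ᵥ x ∈ Us})
    (hTchar : Ts = {x ∈ Xs | ∀ k : ℕ, ((A + B * Kinf) ^ k) *ᵥ x ∈ XU})
    (hXc : IsCompact Xs) (hUc : IsCompact Us) (hTc : IsCompact Ts)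
    (hX0 : (0 : Fin n → ℝ) ∈ interior Xs)
    (hU0 : (0 : Fin m → ℝ) ∈ interior Us)
    (hT0 : (0 : Fin n → ℝ) ∈ interior Ts)
    (hXint : interior Xs = {x | ∀ i, (Cx *ᵥ x) i < cx i})
    (hUint : interior Us = {v | ∀ j, (Cu *ᵥ v) j < cu j})
    (hTint : interior Ts = {x | ∀ r, (Ct *ᵥ x) r < ct r})
    (N : ℕ) (hN : 1 ≤ N) (l : ℕ)
    (x0 : Fin n → ℝ) (u : ℕ → Fin m → ℝ)
    (hu : IsOptimal A B Q R P Cx cx Cu cu Ct ct N x0 u)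
    (hterm : ∀ r, (Ct *ᵥ traj A B x0 u N) r < ct r)
    (uext : ℕ → Fin m → ℝ)
    (huext : uext = fun k => if k < N then u k
      else Kinf *ᵥ (((A + B * Kinf) ^ (k - N)) *ᵥ traj A B x0 u N)) :
    x0 ∈ FeasSet A B Cx cx Cu cu Ct ct (N + l) ∧
    IsOptimal A B Q R P Cx cx Cu cu Ct ct (N + l) x0 uext ∧
    (∀ v, IsOptimal A B Q R P Cx cx Cu cu Ct ct (N + l) x0 v → ∀ k < N + l, v k = uext k) ∧
    (∀ k < N,
      (∀ i, (Cx *ᵥ traj A B x0 uext k) i = cx i ↔ (Cx *ᵥ traj A B x0 u k) i = cx i) ∧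
      (∀ j, (Cu *ᵥ uext k) j = cu j ↔ (Cu *ᵥ u k) j = cu j)) ∧
    (∀ k, N ≤ k → k < N + l →
      (∀ i, (Cx *ᵥ traj A B x0 uext k) i < cx i) ∧ (∀ j, (Cu *ᵥ uext k) j < cu j)) ∧
    (∀ r, (Ct *ᵥ traj A B x0 uext (N + l)) r < ct r) := by
  have hRt : Rᵀ = R := by simpa using hR.isHermitian.eq
  have hPt : Pᵀ = P := by simpa using hP.isHermitian.eq
  have hS : (R + Bᵀ * P * B).PosDef :=
    hR.add_posSemidef (by simpa using hP.conjTranspose_mul_mul_same B)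
  have hq (w : Fin m → ℝ) : 0 ≤ w ⬝ᵥ ((R + Bᵀ * P * B) *ᵥ w) := by
    simpa using hS.posSemidef.dotProduct_mulVec_nonneg w
  have hq0 (w : Fin m → ℝ) (hw : w ⬝ᵥ ((R + Bᵀ * P * B) *ᵥ w) ≤ 0) : w = 0 := by
    by_contra hne
    have := hS.dotProduct_mulVec_pos hne
    simp only [star_trivial] at this
    linarith
  have hcx (i) : 0 < cx i := by rw [hXint] at hX0; simpa using hX0 i
  have hcu (j) : 0 < cu j := by rw [hUint] at hU0; simpa using hU0 j
  have hct (r) : 0 < ct r := by rw [hTint] at hT0; simpa using hT0 r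
  have hu_lt (k) (hk : k < N) : uext k = u k := by rw [huext]; exact if_pos hk
  have htraj (k) (hk : k ≤ N) : traj A B x0 uext k = traj A B x0 u k :=
    traj_congr A B x0 fun j hj => hu_lt j (hj.trans_le hk)
  have hu_ge (j) : uext (N + j) = Kinf *ᵥ ((A + B * Kinf) ^ j *ᵥ traj A B x0 uext N) := by
    rw [htraj N le_rfl, huext]
    simp
  have htail := traj_feedback A B Kinf x0 uext N hu_ge
  obtain ⟨t, ht0, -, ht⟩ := exists_pos_lineMap_lt hterm ((2 : ℝ) • (Ct *ᵥ traj A B x0 u N))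
  have hscaled : (1 + t) • traj A B x0 u N ∈ Ts := by
    rw [hTs]
    intro r
    have := (ht r).le
    simp only [Pi.smul_apply, smul_eq_mul, mulVec_smul] at this ⊢
    linarith
  have hXU' (j) : (1 + t) • ((A + B * Kinf) ^ j *ᵥ traj A B x0 u N) ∈ XU := by
    rw [hTchar] at hscaled
    simpa only [mulVec_smul] using hscaled.2 j
  have hT' (j) : (1 + t) • ((A + B * Kinf) ^ j *ᵥ traj A B x0 u N) ∈ Ts := by
    rw [hTchar]
    refine ⟨?_, fun k => ?_⟩
    · have := hXU' j
      rw [hXU] at this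
      exact this.1
    · rw [mulVec_smul, mulVec_mulVec, ← pow_add]
      exact hXU' (k + j)
  have hx_tail (j i) : (Cx *ᵥ traj A B x0 uext (N + j)) i < cx i := by
    have := hXU' j
    rw [hXU, hXs] at this
    rw [htail, htraj N le_rfl]
    exact mulVec_lt_of_smul_le ht0 hcx this.1 i
  have hu_tail (j i) : (Cu *ᵥ uext (N + j)) i < cu i := by
    have := hXU' j
    rw [hXU, hUs] at this
    rw [hu_ge, htraj N le_rfl]
    exact mulVec_lt_of_smul_le ht0 hcu (by simpa only [mulVec_smul, mem_ofPred_eq] using this.2) i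
  have ht_tail (r) : (Ct *ᵥ traj A B x0 uext (N + l)) r < ct r := by
    have := hT' l
    rw [hTs] at this
    rw [htail, htraj N le_rfl]
    exact mulVec_lt_of_smul_le ht0 hct this r
  have hfeas : Feasible A B Cx cx Cu cu Ct ct (N + l) x0 uext := by
    refine ⟨fun k hk => ?_, fun r => (ht_tail r).le⟩
    rcases lt_or_ge k N with h | h
    · rw [htraj k h.le, hu_lt k h]
      exact hu.1.1 k h
    · obtain ⟨j, rfl⟩ := Nat.exists_eq_add_of_le h
      exact ⟨fun i => (hx_tail j i).le, fun i => (hu_tail j i).le⟩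
  have hgap_lt (k) (hk : k < N) :
      feedbackGap A B Kinf x0 uext k = feedbackGap A B Kinf x0 u k := by
    rw [feedbackGap, feedbackGap, htraj k hk.le, hu_lt k hk]
  have hgap_ge (j) : feedbackGap A B Kinf x0 uext (N + j) = 0 := by
    rw [feedbackGap, htail, hu_ge, sub_self]
  have hcost (v) : cost A B Q R P (N + l) x0 v = cost A B Q R P N x0 v +
      (1 / 2) * ∑ j ∈ Finset.range l, feedbackGap A B Kinf x0 v (N + j) ⬝ᵥ
        ((R + Bᵀ * P * B) *ᵥ feedbackGap A B Kinf x0 v (N + j)) := by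
    rw [cost_eq_sum_feedbackGap hRt hPt hdet hRic hK, cost_eq_sum_feedbackGap hRt hPt hdet hRic hK,
      Finset.sum_range_add]
    ring
  have hcost_ext : cost A B Q R P (N + l) x0 uext = cost A B Q R P N x0 u := by
    rw [hcost, cost_eq_sum_feedbackGap hRt hPt hdet hRic hK,
      cost_eq_sum_feedbackGap hRt hPt hdet hRic hK,
      Finset.sum_congr rfl fun k hk => by rw [hgap_lt k (Finset.mem_range.1 hk)]]
    simp [hgap_ge]
  have hmargin (v) (hv : Feasible A B Cx cx Cu cu Ct ct (N + l) x0 v) :=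
    hu.cost_add_le hRt hPt hS hRic hK hterm fun k hk => hv.1 k (by omega)
  have hhead_nonneg (v : ℕ → Fin m → ℝ) : 0 ≤ ∑ k ∈ Finset.range N,
      (feedbackGap A B Kinf x0 v k - feedbackGap A B Kinf x0 u k) ⬝ᵥ
        ((R + Bᵀ * P * B) *ᵥ (feedbackGap A B Kinf x0 v k - feedbackGap A B Kinf x0 u k)) :=
    Finset.sum_nonneg fun _ _ => hq _
  have htail_nonneg (v : ℕ → Fin m → ℝ) : 0 ≤ ∑ j ∈ Finset.range l,
      feedbackGap A B Kinf x0 v (N + j) ⬝ᵥ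
        ((R + Bᵀ * P * B) *ᵥ feedbackGap A B Kinf x0 v (N + j)) :=
    Finset.sum_nonneg fun _ _ => hq _
  refine ⟨⟨uext, hfeas⟩, ⟨hfeas, fun v hv => ?_⟩, fun v hv => ?_, fun k hk => ?_,
    fun k hk _ => ?_, ht_tail⟩
  · rw [hcost_ext, hcost v]
    linarith [hmargin v hv, hhead_nonneg v, htail_nonneg v]
  · have hle := hv.2 uext hfeas
    rw [hcost_ext, hcost v] at hle
    have hm := hmargin v hv.1
    have hhead := hhead_nonneg v
    have htl := htail_nonneg v
    refine eq_of_feedbackGap_eq (A := A) (B := B) (K := Kinf) (x0 := x0) fun k hk => ?_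
    rcases lt_or_ge k N with h | h
    · rw [hgap_lt k h]
      refine sub_eq_zero.1 (hq0 _ (le_trans (Finset.single_le_sum
        (f := fun k => (feedbackGap A B Kinf x0 v k - feedbackGap A B Kinf x0 u k) ⬝ᵥ
          ((R + Bᵀ * P * B) *ᵥ (feedbackGap A B Kinf x0 v k - feedbackGap A B Kinf x0 u k)))
        (fun _ _ => hq _) (Finset.mem_range.2 h)) ?_))
      linarith
    · obtain ⟨j, rfl⟩ := Nat.exists_eq_add_of_le h
      rw [hgap_ge]
      refine hq0 _ (le_trans (Finset.single_le_sum
        (f := fun j => feedbackGap A B Kinf x0 v (N + j) ⬝ᵥ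
          ((R + Bᵀ * P * B) *ᵥ feedbackGap A B Kinf x0 v (N + j)))
        (fun _ _ => hq _) (Finset.mem_range.2 (by omega : j < l))) ?_)
      linarith
  · rw [htraj k hk.le, hu_lt k hk]
    exact ⟨fun _ => Iff.rfl, fun _ => Iff.rfl⟩
  · obtain ⟨j, rfl⟩ := Nat.exists_eq_add_of_le hk
    exact ⟨hx_tail j, hu_tail j⟩
end
end
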